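/- Let I = {1, …, m}, and for each i ∈ I let J_i and K_i be finite nonempty index sets and g_{ij}, h_{ik} : ℝⁿ → ℝ continuously differentiable functions (j ∈ J_i, k ∈ K_i). Define F = (f₁, …, f_m) : ℝⁿ → ℝᵐ by f_i(x) = max_{j∈J_i} g_{ij}(x) − max_{k∈K_i} h_{ik}(x). Fix x ∈ ℝⁿ. For each i, let J_i(x) and K_i(x) be the active index sets at x, let T_i ⊆ J_i(x) and S_i ⊆ K_i(x) be obtained from the gradients {∇g_{ij}(x)}_{j∈J_i(x)} and {∇h_{ik}(x)}_{k∈K_i(x)} respectively by the iterated coordinate-argmin procedure, and choose arbitrary j_i ∈ T_i, k_i ∈ S_i. Let ξ ∈ ℝ^{m×n} be the matrix whose i-th row is ∇g_{i j_i}(x) − ∇h_{i k_i}(x). Then there exists a nonempty open convex cone U ⊆ ℝⁿ such that for every y ∈ U and every i ∈ I, the one-sided directional derivative f_i′(x;y) exists and equals ⟨ξ_i, y⟩, where ξ_i is the i-th row of ξ; that is, the directional derivative map y ↦ F′(x;y) coincides with the linear map y ↦ ξy on U. -/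

import Mathlib

open scoped Classical RealInnerProductSpace
open Filter Topology

/-- One-sided directional derivative: `f′(x;y) = lim_{t↓0} (f(x+ty) − f(x))/t = d`. -/
def HasDirDeriv {n : ℕ} (f : EuclideanSpace ℝ (Fin n) → ℝ)
    (x y : EuclideanSpace ℝ (Fin n)) (d : ℝ) : Prop :=
  Tendsto (fun t : ℝ => (f (x + t • y) - f x) / t) (𝓝[>] (0 : ℝ)) (𝓝 d)

/-- Pointwise maximum of a finite family of functions. -/
noncomputable def fmax {n : ℕ} {J : Type*} [Fintype J] [Nonempty J]
    (f : J → EuclideanSpace ℝ (Fin n) → ℝ) (x : EuclideanSpace ℝ (Fin n)) : ℝ :=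
  Finset.univ.sup' Finset.univ_nonempty (fun j => f j x)

/-- The active index set `J(x) = {j ∈ J : f_j(x) = max_{i∈J} f_i(x)}`. -/
noncomputable def activeSet {n : ℕ} {J : Type*} [Fintype J] [Nonempty J]
    (f : J → EuclideanSpace ℝ (Fin n) → ℝ) (x : EuclideanSpace ℝ (Fin n)) : Finset J :=
  Finset.univ.filter (fun j => f j x = fmax f x)

/-- Iterated coordinate-argmin sets: `T⁰ = T0` and, for `l = 1, …, n`,
`Tˡ = {t ∈ T^{l−1} : ⟨v_t, e_l⟩ = min_{s ∈ T^{l−1}} ⟨v_s, e_l⟩}` (note that `⟨v, e_l⟩` is the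
`l`-th coordinate of `v`, i.e. coordinate `l - 1` in `Fin n`). -/
noncomputable def Titer {n : ℕ} {J : Type*} (v : J → EuclideanSpace ℝ (Fin n))
    (T0 : Finset J) : ℕ → Finset J
  | 0 => T0
  | l + 1 =>
    if h : l < n then
      (Titer v T0 l).filter fun t => ∀ s ∈ Titer v T0 l, v t ⟨l, h⟩ ≤ v s ⟨l, h⟩
    else Titer v T0 l

theorem Titer_lex {n : ℕ} {J : Type*} (v : J → EuclideanSpace ℝ (Fin n)) (T0 : Finset J)
    (l : ℕ) {t : J} (ht : t ∈ Titer v T0 l) {s : J} (hs : s ∈ T0) :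
    (s ∈ Titer v T0 l ∧ ∀ k : Fin n, (k : ℕ) < l → v s k = v t k) ∨
      ∃ k : Fin n, (∀ k' < k, v s k' = v t k') ∧ v t k < v s k := by
  induction l with
  | zero => exact Or.inl ⟨hs, fun k hk => absurd hk (Nat.not_lt_zero _)⟩
  | succ l ih =>
    by_cases h : l < n
    · simp only [Titer, h, dite_true, Finset.mem_filter] at ht ⊢
      rcases ih ht.1 with ⟨hsl, hag⟩ | hlt
      · rcases (ht.2 s hsl).lt_or_eq with hlt | heq
        · exact Or.inr ⟨⟨l, h⟩, fun k' hk' => hag k' hk', hlt⟩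
        · refine Or.inl ⟨⟨hsl, fun r hr => heq ▸ ht.2 r hr⟩, fun k hk => ?_⟩
          rcases (Nat.lt_succ_iff.1 hk).lt_or_eq with hk | hk
          · exact hag k hk
          · obtain rfl : k = ⟨l, h⟩ := Fin.ext hk
            exact heq.symm
      · exact Or.inr hlt
    · simp only [Titer, h, dite_false] at ht ⊢
      rcases ih ht with ⟨hsl, hag⟩ | hlt
      · exact Or.inl ⟨hsl, fun k _ => hag k (by omega)⟩
      · exact Or.inr hlt

theorem Titer_subset {n : ℕ} {J : Type*} (v : J → EuclideanSpace ℝ (Fin n)) (T0 : Finset J)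
    (l : ℕ) : Titer v T0 l ⊆ T0 := by
  induction l with
  | zero => exact subset_rfl
  | succ l ih =>
    simp only [Titer]
    split_ifs
    · exact (Finset.filter_subset _ _).trans ih
    · exact ih

/-- The vector `-(1, ε, ε², …)`, whose pairing orders vectors reverse-lexicographically as
`ε ↓ 0`. -/
noncomputable def negPowers (n : ℕ) (ε : ℝ) : EuclideanSpace ℝ (Fin n) :=
  WithLp.toLp 2 fun k => -ε ^ (k : ℕ)

theorem eventually_inner_negPowers_lt {n : ℕ} {a b : EuclideanSpace ℝ (Fin n)} (l : Fin n)
    (heq : ∀ k < l, b k = a k) (hlt : a l < b l) :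
    ∀ᶠ ε in 𝓝[>] (0 : ℝ), ⟪b, negPowers n ε⟫ < ⟪a, negPowers n ε⟫ := by
  let φ : ℝ → ℝ := fun ε => ∑ k : Fin n, (b k - a k) * ε ^ ((k : ℕ) - (l : ℕ))
  have hφ : Continuous φ := by fun_prop
  have hφ0 : φ 0 = b l - a l := by
    refine (Finset.sum_eq_single l (fun k _ hk => ?_) (by simp)).trans (by simp)
    rcases hk.lt_or_gt with hk | hk
    · simp [heq k hk]
    · rw [zero_pow (Nat.sub_ne_zero_of_lt hk), mul_zero]
  have hpos : ∀ᶠ ε in 𝓝 (0 : ℝ), 0 < φ ε :=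
    hφ.continuousAt.eventually (lt_mem_nhds (by rw [hφ0]; linarith))
  filter_upwards [nhdsWithin_le_nhds hpos, self_mem_nhdsWithin] with ε hε hε0
  have hfactor : ⟪a, negPowers n ε⟫ - ⟪b, negPowers n ε⟫ = ε ^ (l : ℕ) * φ ε := by
    rw [← inner_sub_left, PiLp.inner_apply, Finset.mul_sum]
    refine Finset.sum_congr rfl fun k _ => ?_
    rcases lt_or_ge k l with hk | hk
    · simp [heq k hk]
    · have : ε ^ (k : ℕ) = ε ^ (l : ℕ) * ε ^ ((k : ℕ) - (l : ℕ)) := by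
        rw [← pow_add, Nat.add_sub_cancel' hk]
      simp only [negPowers, PiLp.sub_apply, RCLike.inner_apply, conj_trivial, this]
      ring
  have := mul_pos (pow_pos (Set.mem_Ioi.1 hε0) (l : ℕ)) hε
  linarith

/-- Directions in which the vector `v j₀` is the strict maximizer among the `v j`, `j ∈ A`,
up to coincidences `v j = v j₀`. -/
def maximizerCone {n : ℕ} {J : Type*} (v : J → EuclideanSpace ℝ (Fin n)) (A : Finset J)
    (j₀ : J) : Set (EuclideanSpace ℝ (Fin n)) :=
  {y | ∀ j ∈ A, v j ≠ v j₀ → ⟪v j, y⟫ < ⟪v j₀, y⟫}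

section maximizerCone

variable {n : ℕ} {J : Type*} (v : J → EuclideanSpace ℝ (Fin n)) (A : Finset J) (j₀ : J)

theorem isOpen_maximizerCone : IsOpen (maximizerCone v A j₀) := by
  simp only [maximizerCone, Set.ofPred_forall]
  refine isOpen_biInter_finset fun j _ => isOpen_iInter_of_finite fun _ => ?_
  exact isOpen_lt (by fun_prop) (by fun_prop)

theorem convex_maximizerCone : Convex ℝ (maximizerCone v A j₀) := by
  intro y hy z hz a b ha hb hab j hj hne
  have hy := hy j hj hne
  have hz := hz j hj hne
  simp only [inner_add_right, real_inner_smul_right]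
  rcases ha.eq_or_lt with rfl | ha
  · obtain rfl : b = 1 := by linarith
    simpa using hz
  · exact add_lt_add_of_lt_of_le (mul_lt_mul_of_pos_left hy ha)
      (mul_le_mul_of_nonneg_left hz.le hb)

variable {v A j₀}

theorem smul_mem_maximizerCone {y : EuclideanSpace ℝ (Fin n)} (hy : y ∈ maximizerCone v A j₀)
    {t : ℝ} (ht : 0 < t) : t • y ∈ maximizerCone v A j₀ := by
  intro j hj hne
  simpa only [real_inner_smul_right] using mul_lt_mul_of_pos_left (hy j hj hne) ht

theorem inner_le_of_mem_maximizerCone {y : EuclideanSpace ℝ (Fin n)}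
    (hy : y ∈ maximizerCone v A j₀) {j : J} (hj : j ∈ A) : ⟪v j, y⟫ ≤ ⟪v j₀, y⟫ := by
  by_cases h : v j = v j₀
  · rw [h]
  · exact (hy j hj h).le

theorem eventually_negPowers_mem_maximizerCone (hj₀ : j₀ ∈ Titer v A n) :
    ∀ᶠ ε in 𝓝[>] (0 : ℝ), negPowers n ε ∈ maximizerCone v A j₀ := by
  simp only [maximizerCone, Set.mem_ofPred_eq]
  rw [Filter.eventually_all_finset]
  intro j hj
  rcases Titer_lex v A n hj₀ hj with ⟨-, hag⟩ | ⟨l, heq, hlt⟩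
  · exact Eventually.of_forall fun _ hne => absurd (PiLp.ext fun k => hag k k.2) hne
  · exact (eventually_inner_negPowers_lt l heq hlt).mono fun _ hε _ => hε

end maximizerCone

theorem hasDirDeriv_gradient {n : ℕ} {f : EuclideanSpace ℝ (Fin n) → ℝ}
    {x : EuclideanSpace ℝ (Fin n)} (hf : DifferentiableAt ℝ f x)
    (y : EuclideanSpace ℝ (Fin n)) : HasDirDeriv f x y ⟪gradient f x, y⟫ := by
  have h := (hf.hasGradientAt.hasFDerivAt.hasLineDerivAt y).tendsto_slope_zero_right
  simpa [HasDirDeriv, div_eq_inv_mul] using h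

theorem HasDirDeriv.sub {n : ℕ} {f g : EuclideanSpace ℝ (Fin n) → ℝ}
    {x y : EuclideanSpace ℝ (Fin n)} {c d : ℝ} (hf : HasDirDeriv f x y c)
    (hg : HasDirDeriv g x y d) : HasDirDeriv (fun z => f z - g z) x y (c - d) := by
  refine (Tendsto.sub hf hg).congr fun t => ?_
  ring

theorem hasDirDeriv_fmax {n : ℕ} {J : Type*} [Fintype J] [Nonempty J]
    {f : J → EuclideanSpace ℝ (Fin n) → ℝ} {x y : EuclideanSpace ℝ (Fin n)}
    (hf : ∀ j, DifferentiableAt ℝ (f j) x) {j₀ : J} (hj₀ : j₀ ∈ activeSet f x)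
    (hmax : ∀ j ∈ activeSet f x, ⟪gradient (f j) x, y⟫ ≤ ⟪gradient (f j₀) x, y⟫) :
    HasDirDeriv (fmax f) x y ⟪gradient (f j₀) x, y⟫ := by
  have hle : ∀ j z, f j z ≤ fmax f z := fun j z =>
    Finset.le_sup' (fun j => f j z) (Finset.mem_univ j)
  have hact : ∀ {j}, j ∈ activeSet f x ↔ f j x = fmax f x := by simp [activeSet]
  refine tendsto_order.2 ⟨fun c hc => ?_, fun c hc => ?_⟩
  · filter_upwards [(hasDirDeriv_gradient (hf j₀) y).eventually (lt_mem_nhds hc),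
      self_mem_nhdsWithin] with t ht ht0
    refine ht.trans_le (div_le_div_of_nonneg_right ?_ (Set.mem_Ioi.1 ht0).le)
    rw [hact.1 hj₀]
    exact sub_le_sub_right (hle _ _) _
  · have key : ∀ j, ∀ᶠ t in 𝓝[>] (0 : ℝ), f j (x + t • y) < fmax f x + c * t := by
      intro j
      by_cases hj : j ∈ activeSet f x
      · filter_upwards [(hasDirDeriv_gradient (hf j) y).eventually
          (gt_mem_nhds ((hmax j hj).trans_lt hc)), self_mem_nhdsWithin] with t ht ht0
        rw [div_lt_iff₀ (Set.mem_Ioi.1 ht0), hact.1 hj] at ht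
        linarith
      · have hcont : ContinuousAt (fun t : ℝ => f j (x + t • y)) 0 :=
          ContinuousAt.comp (by simpa using (hf j).continuousAt) (by fun_prop)
        have hlt : f j (x + (0 : ℝ) • y) < fmax f x + c * 0 := by
          simpa using lt_of_le_of_ne (hle j x) fun h => hj (hact.2 h)
        exact nhdsWithin_le_nhds
          (hcont.eventually_lt (g := fun t : ℝ => fmax f x + c * t) (by fun_prop) hlt)
    filter_upwards [eventually_all.2 key, self_mem_nhdsWithin] with t ht ht0
    rw [div_lt_iff₀ (Set.mem_Ioi.1 ht0), sub_lt_iff_lt_add']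
    exact (Finset.sup'_lt_iff _).2 fun j _ => ht j

/-- correctness of Algorithm A1. With `f_i = max_j g_{ij} − max_k h_{ik}`,
`T_i`, `S_i` the iterated coordinate-argmin sets of the active gradients of the `g_{ij}` and
`h_{ik}` at `x`, arbitrary selections `j_i ∈ T_i`, `k_i ∈ S_i`, and `ξ` the matrix with rows
`ξ_i = ∇g_{i j_i}(x) − ∇h_{i k_i}(x)`, there is a nonempty open convex cone `U` such that for
every `y ∈ U` and every `i`, the directional derivative `f_i′(x;y)` exists and equals
`⟨ξ_i, y⟩`. -/
theorem algorithmA1_dirDeriv_linear {n m : ℕ}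
    (J K : Fin m → Type*) [∀ i, Fintype (J i)] [∀ i, Nonempty (J i)]
    [∀ i, Fintype (K i)] [∀ i, Nonempty (K i)]
    (g : (i : Fin m) → J i → EuclideanSpace ℝ (Fin n) → ℝ)
    (h : (i : Fin m) → K i → EuclideanSpace ℝ (Fin n) → ℝ)
    (hg : ∀ i j, ContDiff ℝ 1 (g i j)) (hh : ∀ i k, ContDiff ℝ 1 (h i k))
    (x : EuclideanSpace ℝ (Fin n))
    (jsel : (i : Fin m) → J i) (ksel : (i : Fin m) → K i)
    (hjsel : ∀ i, jsel i ∈ Titer (fun j => gradient (g i j) x) (activeSet (g i) x) n)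
    (hksel : ∀ i, ksel i ∈ Titer (fun k => gradient (h i k) x) (activeSet (h i) x) n)
    (ξ : Fin m → EuclideanSpace ℝ (Fin n))
    (hξ : ∀ i, ξ i = gradient (g i (jsel i)) x - gradient (h i (ksel i)) x) :
    ∃ U : Set (EuclideanSpace ℝ (Fin n)),
      U.Nonempty ∧ IsOpen U ∧ Convex ℝ U ∧
      (∀ y ∈ U, ∀ t : ℝ, 0 < t → t • y ∈ U) ∧
      (∀ y ∈ U, ∀ i : Fin m,
        HasDirDeriv (fun z => fmax (g i) z - fmax (h i) z) x y ⟪ξ i, y⟫) := by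
  let V : Fin m → Set (EuclideanSpace ℝ (Fin n)) := fun i =>
    maximizerCone (fun j => gradient (g i j) x) (activeSet (g i) x) (jsel i) ∩
      maximizerCone (fun k => gradient (h i k) x) (activeSet (h i) x) (ksel i)
  refine ⟨⋂ i, V i, ?_, isOpen_iInter_of_finite fun i => ?_, convex_iInter fun i => ?_, ?_, ?_⟩
  · have hev : ∀ᶠ ε in 𝓝[>] (0 : ℝ), ∀ i, negPowers n ε ∈ V i :=
      eventually_all.2 fun i => (eventually_negPowers_mem_maximizerCone (hjsel i)).and
        (eventually_negPowers_mem_maximizerCone (hksel i))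
    obtain ⟨ε, hε⟩ := hev.exists
    exact ⟨negPowers n ε, Set.mem_iInter.2 hε⟩
  · exact (isOpen_maximizerCone _ _ _).inter (isOpen_maximizerCone _ _ _)
  · exact (convex_maximizerCone _ _ _).inter (convex_maximizerCone _ _ _)
  · intro y hy t ht
    refine Set.mem_iInter.2 fun i => ?_
    have hyi := Set.mem_iInter.1 hy i
    exact ⟨smul_mem_maximizerCone hyi.1 ht, smul_mem_maximizerCone hyi.2 ht⟩
  · intro y hy i
    have hyi := Set.mem_iInter.1 hy i
    rw [hξ i, inner_sub_left]
    exact (hasDirDeriv_fmax (fun j => (hg i j).differentiable one_ne_zero x)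
        (Titer_subset _ _ _ (hjsel i)) fun j hj => inner_le_of_mem_maximizerCone hyi.1 hj).sub
      (hasDirDeriv_fmax (fun k => (hh i k).differentiable one_ne_zero x)
        (Titer_subset _ _ _ (hksel i)) fun k hk => inner_le_of_mem_maximizerCone hyi.2 hk)
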